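/- For integers q₂ > q₁ > p > 1 with gcd(p,q₁) = gcd(p,q₂) = 1, the ratio f_{p,q₂}(n)/f_{p,q₁}(n) tends to 0 as n → ∞; in particular f_{p,q₁}(n) > f_{p,q₂}(n) for all sufficiently large n. -/

import Mathlib

open Filter Real

/-- Number of representations of `n` as a sum of distinct terms of the form `p^a * q^b`. -/
noncomputable def fpq (p q n : ℕ) : ℕ :=
  Set.ncard {S : Finset ℕ | (∀ k ∈ S, ∃ a b : ℕ, k = p ^ a * q ^ b) ∧ S.sum id = n}


/-- Sums of finite subsets of `A`. -/
def FS (A : Set ℕ) : Set ℕ := {n | ∃ S : Finset ℕ, (∀ k ∈ S, k ∈ A) ∧ S.sum id = n}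

lemma FS_mono {A B : Set ℕ} (h : ∀ k ∈ A, k ∈ B) {n : ℕ} (hn : n ∈ FS A) : n ∈ FS B := by
  obtain ⟨S, hS, rfl⟩ := hn
  exact ⟨S, fun k hk => h k (hS k hk), rfl⟩

lemma FS_zero (A : Set ℕ) : 0 ∈ FS A := ⟨∅, by simp, by simp⟩

lemma FS_single {A : Set ℕ} {n : ℕ} (h : n ∈ A) : n ∈ FS A :=
  ⟨{n}, by simpa using h, by simp⟩

lemma FS_add {A B C : Set ℕ} (hAB : ∀ k ∈ A, k ∉ B) (hA : ∀ k ∈ A, k ∈ C) (hB : ∀ k ∈ B, k ∈ C)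
    {m n : ℕ} (hm : m ∈ FS A) (hn : n ∈ FS B) : m + n ∈ FS C := by
  obtain ⟨S, hS, rfl⟩ := hm
  obtain ⟨S', hS', rfl⟩ := hn
  refine ⟨S ∪ S', ?_, ?_⟩
  · intro k hk
    rcases Finset.mem_union.1 hk with h | h
    · exact hA k (hS k h)
    · exact hB k (hS' k h)
  · rw [Finset.sum_union]
    rw [Finset.disjoint_left]
    intro k hk hk'
    exact hAB k (hS k hk) (hS' k hk')

lemma FS_mul {A B : Set ℕ} {c : ℕ} (hc : 0 < c) (h : ∀ k ∈ A, c * k ∈ B) {n : ℕ} (hn : n ∈ FS A) :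
    c * n ∈ FS B := by
  obtain ⟨S, hS, rfl⟩ := hn
  refine ⟨S.image (c * ·), ?_, ?_⟩
  · intro k hk
    obtain ⟨j, hj, rfl⟩ := Finset.mem_image.1 hk
    exact h j (hS j hj)
  · rw [Finset.sum_image, Finset.mul_sum]
    · rfl
    · intro x _ y _ hxy
      exact Nat.eq_of_mul_eq_mul_left hc hxy

lemma FS_bdd {A : Set ℕ} {n : ℕ} (hn : n ∈ FS A) : ∃ Y, n ∈ FS {k | k ∈ A ∧ k < Y} := by
  obtain ⟨S, hS, rfl⟩ := hn
  refine ⟨S.sup id + 1, S, fun k hk => ⟨hS k hk, ?_⟩, rfl⟩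
  have : id k ≤ S.sup id := Finset.le_sup hk
  simp at this
  omega

lemma pq_inj {p q a b a' b' : ℕ} (hp : 1 < p) (hq : 1 < q) (hc : Nat.Coprime p q)
    (h : p ^ a * q ^ b = p ^ a' * q ^ b') : a = a' ∧ b = b' := by
  have key : ∀ a b a' b' : ℕ, p ^ a * q ^ b = p ^ a' * q ^ b' → a' ≤ a := by
    intro a b a' b' h
    have h1 : p ^ a' ∣ p ^ a * q ^ b := h ▸ Dvd.intro _ rfl
    have h2 : p ^ a' ∣ p ^ a := (Nat.Coprime.pow a' b hc).dvd_of_dvd_mul_right h1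
    exact (Nat.pow_dvd_pow_iff_le_right hp).1 h2
  have ha : a = a' := le_antisymm (key _ _ _ _ h.symm) (key _ _ _ _ h)
  subst ha
  refine ⟨rfl, Nat.pow_right_injective hq ?_⟩
  exact Nat.eq_of_mul_eq_mul_left (pow_pos (by omega) a) h

def T1 (p q : ℕ) : Set ℕ := {k | ∃ a b, 1 ≤ b ∧ b ≤ p ∧ k = p ^ a * q ^ b}

open Classical in
lemma sum_lower {p q : ℕ} (hp : 1 < p) (hq : 1 < q) (hc : Nat.Coprime p q) (x : ℕ)
    (hx : q ^ p ≤ x) :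
    x + 1 ≤ ∑ k ∈ (Finset.range (x + 1)).filter (· ∈ T1 p q), k := by
  set t : ℕ → ℕ := fun b => p ^ (Nat.log p (x / q ^ b)) * q ^ b with ht
  have hle : ∀ b ∈ Finset.Icc 1 p, t b ≤ x ∧ x + 1 ≤ p * t b := by
    intro b hb
    rw [Finset.mem_Icc] at hb
    have hqb : 0 < q ^ b := pow_pos (by omega) b
    have hbx : q ^ b ≤ x := le_trans (Nat.pow_le_pow_right (by omega) hb.2) hx
    have hne : x / q ^ b ≠ 0 := by
      have := Nat.div_pos hbx hqb
      omega
    constructor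
    · have := Nat.pow_log_le_self p hne
      calc t b ≤ (x / q ^ b) * q ^ b := Nat.mul_le_mul_right _ this
        _ ≤ x := Nat.div_mul_le_self _ _
    · have := Nat.lt_pow_succ_log_self hp (x / q ^ b)
      rw [Nat.div_lt_iff_lt_mul hqb] at this
      have e : p * t b = p ^ (Nat.log p (x / q ^ b)).succ * q ^ b := by
        simp only [ht, Nat.succ_eq_add_one, pow_succ]; ring
      rw [e]; exact this
  have hinj : Set.InjOn t (Finset.Icc 1 p) := by
    intro b _ b' _ h
    exact (pq_inj hp hq hc h).2
  have h1 : ∑ k ∈ (Finset.Icc 1 p).image t, k ≤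
      ∑ k ∈ (Finset.range (x + 1)).filter (· ∈ T1 p q), k := by
    apply Finset.sum_le_sum_of_subset
    intro k hk
    obtain ⟨b, hb, rfl⟩ := Finset.mem_image.1 hk
    have := (hle b hb).1
    rw [Finset.mem_Icc] at hb
    rw [Finset.mem_filter, Finset.mem_range]
    exact ⟨by omega, _, b, hb.1, hb.2, rfl⟩
  rw [Finset.sum_image hinj] at h1
  refine le_trans ?_ h1
  have h2 : ∑ b ∈ Finset.Icc 1 p, (x + 1) ≤ ∑ b ∈ Finset.Icc 1 p, p * t b :=
    Finset.sum_le_sum fun b hb => (hle b hb).2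
  rw [← Finset.mul_sum] at h2
  simp only [Finset.sum_const, Nat.card_Icc, smul_eq_mul, Nat.add_sub_cancel] at h2
  exact Nat.le_of_mul_le_mul_left h2 (by omega)

open Classical in
lemma gap {p q : ℕ} (hp : 1 < p) (hq : 1 < q) (hc : Nat.Coprime p q) (n : ℕ) :
    ∃ r ∈ FS (T1 p q), r ≤ n ∧ n ≤ r + q ^ p := by
  have key : ∀ x n : ℕ, n ≤ ∑ k ∈ (Finset.range (x + 1)).filter (· ∈ T1 p q), k →
      ∃ r ∈ FS {k | k ∈ T1 p q ∧ k ≤ x}, r ≤ n ∧ n ≤ r + q ^ p := by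
    intro x
    induction x with
    | zero =>
      intro n hn
      refine ⟨0, FS_zero _, by omega, ?_⟩
      have : ∑ k ∈ (Finset.range (0 + 1)).filter (· ∈ T1 p q), k = 0 := by
        apply Finset.sum_eq_zero
        intro k hk
        have := Finset.mem_range.1 (Finset.mem_filter.1 hk).1
        omega
      omega
    | succ x ih =>
      intro n hn
      rw [Finset.range_add_one, Finset.filter_insert] at hn
      by_cases hle : n ≤ ∑ k ∈ (Finset.range (x + 1)).filter (· ∈ T1 p q), k
      · obtain ⟨r, hr, h⟩ := ih n hle
        refine ⟨r, FS_mono ?_ hr, h⟩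
        rintro k ⟨h0, h1⟩; exact ⟨h0, by omega⟩
      · split_ifs at hn with hT
        · rw [Finset.sum_insert (by simp)] at hn
          by_cases hn2 : x + 1 ≤ n
          · obtain ⟨r, hr, h⟩ := ih (n - (x + 1)) (by omega)
            refine ⟨r + (x + 1), ?_, by omega, by omega⟩
            refine FS_add (B := {k | k ∈ T1 p q ∧ k = x + 1}) ?_ ?_ ?_ hr (FS_single ⟨hT, rfl⟩)
            · rintro k ⟨_, h1⟩ ⟨_, h2⟩; omega
            · rintro k ⟨h0, h1⟩; exact ⟨h0, by omega⟩
            · rintro k ⟨h0, h1⟩; exact ⟨h0, by omega⟩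
          · refine ⟨∑ k ∈ (Finset.range (x + 1)).filter (· ∈ T1 p q), k, ?_, by omega, ?_⟩
            · refine ⟨_, ?_, rfl⟩
              intro k hk
              rw [Finset.mem_filter, Finset.mem_range] at hk
              exact ⟨hk.2, by omega⟩
            · by_cases hx : q ^ p ≤ x
              · have := sum_lower hp hq hc x hx
                omega
              · omega
        · exact absurd hn hle
  obtain ⟨r, hr, h⟩ := key (n + q ^ p) n (by have := sum_lower hp hq hc (n + q ^ p) (by omega); omega)
  exact ⟨r, FS_mono (fun k hk => hk.1) hr, h⟩

/-- Window of `U`. -/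
def Win (U : Set ℕ) (X Y : ℕ) : Set ℕ := {k | k ∈ U ∧ X ≤ k ∧ k < Y}

def Swap (U : Set ℕ) (X g : ℕ) : Prop := ∃ Y y, y ∈ FS (Win U X Y) ∧ y + g ∈ FS (Win U X Y)

lemma Win_add {U : Set ℕ} {X Y X' Y' m n : ℕ} (h : Y ≤ X') (hX : X ≤ X') (hm : m ∈ FS (Win U X Y))
    (hn : n ∈ FS (Win U X' Y')) : m + n ∈ FS (Win U X (max Y Y')) := by
  refine FS_add ?_ ?_ ?_ hm hn
  · rintro k ⟨_, _, h1⟩ ⟨_, h2, _⟩; omega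
  · rintro k ⟨h0, h1, h2⟩; exact ⟨h0, h1, by omega⟩
  · rintro k ⟨h0, h1, h2⟩; exact ⟨h0, by omega, by omega⟩

lemma Swap_mul {U : Set ℕ} {g : ℕ} (h : ∀ X, Swap U X g) (m X : ℕ) : Swap U X (m * g) := by
  induction m with
  | zero => exact ⟨0, 0, FS_zero _, by simpa using FS_zero _⟩
  | succ m ih =>
    obtain ⟨Y, y, h1, h2⟩ := ih
    obtain ⟨Y', y', h1', h2'⟩ := h (max X Y)
    refine ⟨max Y Y', y + y', Win_add (by omega) (by omega) h1 h1', ?_⟩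
    have := Win_add (by omega) (by omega) h2 h2'
    convert this using 1
    ring

lemma Swap_anti {U : Set ℕ} {X X' g : ℕ} (hX : X ≤ X') (h : Swap U X' g) : Swap U X g := by
  obtain ⟨Y, y, h1, h2⟩ := h
  have : ∀ k ∈ Win U X' Y, k ∈ Win U X Y := by
    rintro k ⟨h0, h1, h2⟩; exact ⟨h0, by omega, by omega⟩
  exact ⟨Y, y, FS_mono this h1, FS_mono this h2⟩

lemma run {U : Set ℕ} (h : ∀ X, Swap U X 1) (N : ℕ) : ∃ c Y, ∀ e ≤ N, c + e ∈ FS (Win U 0 Y) := by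
  induction N with
  | zero => exact ⟨0, 0, fun e he => by
      obtain rfl : e = 0 := by omega
      exact FS_zero _⟩
  | succ N ih =>
    obtain ⟨c, Y, hc⟩ := ih
    obtain ⟨Y', y, h1, h2⟩ := h Y
    refine ⟨c + y, max Y Y', fun e he => ?_⟩
    by_cases heN : e ≤ N
    · have := Win_add le_rfl (by omega) (hc e heN) h1
      convert this using 1; ring
    · have := Win_add le_rfl (by omega) (hc N le_rfl) h2
      convert this using 1
      omega

lemma swap_one {U : Set ℕ} {C : ℕ} (hB : ∀ X, ∃ g, 0 < g ∧ g ≤ C ∧ Swap U X g)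
    (hU : ∀ X g, (∀ u ∈ U, X ≤ u → g ∣ u) → g = 1) : ∀ X, Swap U X 1 := by
  classical
  have hex : ∃ g, 0 < g ∧ ∀ X, Swap U X g := by
    by_contra hcon
    push Not at hcon
    choose! F hF using hcon
    obtain ⟨g, h0, h1, h2⟩ := hB ((Finset.range (C + 1)).sup F)
    exact hF g h0 (Swap_anti (Finset.le_sup (f := F) (by simp; omega)) h2)
  obtain ⟨hg0, hg⟩ := Nat.find_spec hex
  have hmin : ∀ g, 0 < g → g < Nat.find hex → ∃ X, ¬ Swap U X g := by
    intro g h0 h1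
    have := Nat.find_min hex h1
    push Not at this
    exact this h0
  set γ := Nat.find hex with hγ
  have : γ = 1 := by
    choose! F hF using hmin
    apply hU ((Finset.range γ).sup F)
    intro u hu hXu
    rw [Nat.dvd_iff_mod_eq_zero]
    by_contra hne
    set X := (Finset.range γ).sup F
    have hlt := Nat.mod_lt u hg0
    apply hF (u % γ) (by omega) hlt
    refine Swap_anti (X' := X) (Finset.le_sup (f := F) (by simpa using hlt)) ?_
    obtain ⟨Y, y, h1, h2⟩ := Swap_mul hg (u / γ) (u + 1)
    have hsub : ∀ k ∈ Win U (u + 1) Y, k ∈ Win U X (max (u + 1) Y) := by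
      rintro k ⟨h0, h1, h2⟩; exact ⟨h0, by omega, by omega⟩
    refine ⟨max (u + 1) Y, y + u / γ * γ, FS_mono hsub h2, ?_⟩
    have hs : u ∈ FS (Win U X (u + 1)) := FS_single ⟨hu, hXu, by omega⟩
    have := Win_add le_rfl (by omega) hs h1
    convert this using 1
    have := Nat.div_add_mod' u γ
    omega
  rwa [this] at hg

def U1 (p q : ℕ) : Set ℕ := {k | ∃ a b, (b = 0 ∨ p + 1 ≤ b) ∧ k = p ^ a * q ^ b}

lemma bdd_swap {p q : ℕ} (hp : 1 < p) (hq : 1 < q) (hc : Nat.Coprime p q) :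
    ∃ C, ∀ X, ∃ g, 0 < g ∧ g ≤ C ∧ Swap (U1 p q) X g := by
  set M := q ^ (p + 1) * (q ^ p + 1) with hM
  have hM0 : 0 < M := Nat.mul_pos (pow_pos (by omega) _) (by omega)
  refine ⟨2 * M, fun X => ?_⟩
  set P := p ^ (X + 2) with hP
  have hPX : X + 2 < P := Nat.lt_pow_self hp
  have hP4 : 4 ≤ P := by
    calc 4 = 2 ^ 2 := by norm_num
      _ ≤ p ^ 2 := Nat.pow_le_pow_left hp 2
      _ ≤ P := Nat.pow_le_pow_right (by omega) (by omega)
  have hpP : p ∣ P := dvd_pow_self p (by omega)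
  set φ := Nat.totient P with hφ
  have hφ0 : 0 < φ := Nat.totient_pos.2 (by omega)
  have hqP : q ^ φ ≡ 1 [MOD P] := Nat.ModEq.pow_totient (Nat.Coprime.pow_right _ hc.symm)
  set β := X + p + 1 with hβ
  set σ : ℕ → ℕ := fun r => ∑ j ∈ Finset.range r, q ^ ((β + j) * φ) with hσ
  have hσmod : ∀ r, σ r ≡ r [MOD P] := by
    intro r
    induction r with
    | zero => simp [hσ]; rfl
    | succ r ih =>
      simp only [hσ, Finset.sum_range_succ]
      refine Nat.ModEq.add ih ?_
      rw [mul_comm, pow_mul]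
      simpa using hqP.pow (β + r)
  have hσFS : ∀ r, σ r ∈ FS {k | ∃ b, β ≤ b ∧ k = q ^ b} := by
    intro r
    refine ⟨(Finset.range r).image (fun j => q ^ ((β + j) * φ)), ?_, ?_⟩
    · intro k hk
      obtain ⟨j, _, rfl⟩ := Finset.mem_image.1 hk
      exact ⟨_, by nlinarith, rfl⟩
    · rw [Finset.sum_image]
      · rfl
      · intro j _ j' _ h
        have h1 := Nat.pow_right_injective hq h
        have h2 := Nat.eq_of_mul_eq_mul_right hφ0 h1
        omega
  set N := ∑ r ∈ Finset.range P, σ r with hN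
  have hσN : ∀ r < P, σ r ≤ N := fun r hr =>
    Finset.single_le_sum (f := σ) (fun _ _ => Nat.zero_le _) (Finset.mem_range.2 hr)
  have hq1 : 0 < q ^ (p + 1) := pow_pos (by omega) _
  have hPq : 0 < P * q ^ (p + 1) := Nat.mul_pos (by omega) hq1
  have hx : ∀ r < P, ∃ x, x ≡ r [MOD P] ∧ N ≤ x ∧ x ≤ N + P * M ∧
      x ∈ FS {k | k ∈ U1 p q ∧ X ≤ k} := by
    intro r hr
    have hr' := hσN r hr
    obtain ⟨ρ, hρ, h1, h2⟩ := gap hp hq hc ((N + P * M - σ r) / (P * q ^ (p + 1)))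
    set n' := (N + P * M - σ r) / (P * q ^ (p + 1)) with hn'
    have h3 : (P * q ^ (p + 1)) * n' ≤ N + P * M - σ r := Nat.mul_div_le _ _
    have h4 : N + P * M - σ r < (P * q ^ (p + 1)) * (n' + 1) := Nat.lt_mul_div_succ _ hPq
    have h5 : (P * q ^ (p + 1)) * ρ ≤ (P * q ^ (p + 1)) * n' := Nat.mul_le_mul_left _ h1
    have h6 : (P * q ^ (p + 1)) * (n' + 1) ≤ (P * q ^ (p + 1)) * (ρ + q ^ p + 1) :=
      Nat.mul_le_mul_left _ (by omega)
    have h7 : (P * q ^ (p + 1)) * (ρ + q ^ p + 1) = (P * q ^ (p + 1)) * ρ + P * M := by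
      rw [hM]; ring
    refine ⟨σ r + (P * q ^ (p + 1)) * ρ, ?_, by omega, by omega, ?_⟩
    · have : (P * q ^ (p + 1)) * ρ ≡ 0 [MOD P] := by
        rw [Nat.modEq_zero_iff_dvd, mul_assoc]; exact Dvd.intro _ rfl
      simpa using (hσmod r).add this
    · refine FS_add (A := {k | ∃ b, β ≤ b ∧ k = q ^ b})
        (B := {k | ∃ t ∈ T1 p q, k = (P * q ^ (p + 1)) * t}) ?_ ?_ ?_ (hσFS r)
        (FS_mul hPq (A := T1 p q) ?_ hρ)
      · rintro k ⟨b, _, rfl⟩ ⟨t, _, h⟩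
        have h8 : p ∣ q ^ b := h ▸ Dvd.dvd.mul_right (Dvd.dvd.mul_right hpP _) _
        have h9 := Nat.Coprime.eq_one_of_dvd (Nat.Coprime.pow_right b hc) h8
        omega
      · rintro k ⟨b, hb, rfl⟩
        refine ⟨⟨0, b, Or.inr (by omega), by simp⟩, ?_⟩
        have : b < q ^ b := Nat.lt_pow_self hq
        omega
      · rintro k ⟨t, ⟨a, b, hb, _, rfl⟩, rfl⟩
        refine ⟨⟨X + 2 + a, p + 1 + b, Or.inr (by omega), by rw [hP]; ring⟩, ?_⟩
        have h8 : 0 < q ^ (p + 1) * (p ^ a * q ^ b) := by positivity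
        rw [mul_assoc]
        nlinarith
      · intro k hk
        exact ⟨k, hk, rfl⟩
  choose! x hx1 hx2 hx3 hx4 using hx
  have hpig : ∃ r ∈ Finset.range P, ∃ r' ∈ Finset.range P, r ≠ r' ∧
      (x r - N) / (2 * M) = (x r' - N) / (2 * M) := by
    apply Finset.exists_ne_map_eq_of_card_lt_of_maps_to (t := Finset.range (P / 2 + 1))
    · simp; omega
    · intro r hr
      simp only [Finset.coe_range, Set.mem_Iio] at hr ⊢
      have := hx3 r hr
      rw [Nat.lt_succ_iff, ← Nat.mul_div_mul_right P 2 hM0]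
      exact Nat.div_le_div_right (by omega)
  have main : ∀ r < P, ∀ r' < P, x r < x r' → (x r - N) / (2 * M) = (x r' - N) / (2 * M) →
      ∃ g, 0 < g ∧ g ≤ 2 * M ∧ Swap (U1 p q) X g := by
    intro r hr r' hr' hlt he
    refine ⟨x r' - x r, by omega, ?_, ?_⟩
    · have a1 := Nat.div_add_mod (x r - N) (2 * M)
      have a2 := Nat.div_add_mod (x r' - N) (2 * M)
      have a3 := Nat.mod_lt (x r' - N) (show 0 < 2 * M by omega)
      rw [he] at a1
      have := hx2 r hr
      have := hx2 r' hr'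
      omega
    · obtain ⟨Y, hY⟩ := FS_bdd (hx4 r hr)
      obtain ⟨Y', hY'⟩ := FS_bdd (hx4 r' hr')
      refine ⟨max Y Y', x r, FS_mono ?_ hY, ?_⟩
      · rintro k ⟨⟨h0, h1⟩, h2⟩; exact ⟨h0, h1, by omega⟩
      · rw [show x r + (x r' - x r) = x r' by omega]
        refine FS_mono ?_ hY'
        rintro k ⟨⟨h0, h1⟩, h2⟩; exact ⟨h0, h1, by omega⟩
  obtain ⟨r, hr, r', hr', hne, he⟩ := hpig
  rw [Finset.mem_range] at hr hr'
  rcases lt_trichotomy (x r) (x r') with h | h | h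
  · exact main r hr r' hr' h he
  · exfalso
    apply hne
    have h1 := hx1 r hr
    rw [h] at h1
    exact Nat.ModEq.eq_of_lt_of_lt (h1.symm.trans (hx1 r' hr')) hr hr'
  · exact main r' hr' r hr h he.symm

theorem birch {p q : ℕ} (hp : 1 < p) (hq : 1 < q) (hc : Nat.Coprime p q) :
    ∃ N, ∀ n ≥ N, n ∈ FS {k | ∃ a b : ℕ, k = p ^ a * q ^ b} := by
  obtain ⟨C, hC⟩ := bdd_swap hp hq hc
  have h1 := swap_one hC (fun X g hg => by
    have ha := hg (p ^ X) ⟨X, 0, Or.inl rfl, by simp⟩ (Nat.lt_pow_self hp).le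
    have hb := hg (q ^ (X + p + 1)) ⟨0, X + p + 1, Or.inr (by omega), by simp⟩
      (by have : X + p + 1 < q ^ (X + p + 1) := Nat.lt_pow_self hq
          omega)
    exact Nat.eq_one_of_dvd_coprimes (Nat.Coprime.pow X (X + p + 1) hc) ha hb)
  obtain ⟨c, Y, hcY⟩ := run h1 (q ^ p)
  refine ⟨c, fun n hn => ?_⟩
  obtain ⟨r, hr, h2, h3⟩ := gap hp hq hc (n - c)
  have h4 := hcY (n - c - r) (by omega)
  have : n = r + (c + (n - c - r)) := by omega
  rw [this]
  refine FS_add ?_ ?_ ?_ hr h4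
  · rintro k ⟨a, b, hb, hb', rfl⟩ ⟨⟨a', b', h, he⟩, _⟩
    have := (pq_inj hp hq hc he).2
    omega
  · rintro k ⟨a, b, _, _, rfl⟩; exact ⟨a, b, rfl⟩
  · rintro k ⟨⟨a, b, _, rfl⟩, _⟩; exact ⟨a, b, rfl⟩

open Classical in
noncomputable def RepF (p q n : ℕ) : Finset (Finset ℕ) :=
  ((Finset.range (n + 1)).powerset).filter
    (fun S => (∀ k ∈ S, ∃ a b : ℕ, k = p ^ a * q ^ b) ∧ S.sum id = n)

lemma mem_RepF {p q n : ℕ} {S : Finset ℕ} :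
    S ∈ RepF p q n ↔ (∀ k ∈ S, ∃ a b : ℕ, k = p ^ a * q ^ b) ∧ S.sum id = n := by
  classical
  unfold RepF
  rw [Finset.mem_filter, Finset.mem_powerset]
  constructor
  · exact fun h => h.2
  · refine fun h => ⟨fun k hk => ?_, h⟩
    have : id k ≤ S.sum id := Finset.single_le_sum (fun _ _ => Nat.zero_le _) hk
    rw [h.2] at this
    simp at this ⊢
    omega

lemma fpq_eq (p q n : ℕ) : fpq p q n = (RepF p q n).card := by
  unfold fpq
  rw [← Set.ncard_coe_finset]
  congr 1
  ext S
  simp [mem_RepF]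

lemma not_dvd_qpow {p q : ℕ} (hp : 1 < p) (hc : Nat.Coprime p q) (b : ℕ) : ¬ p ∣ q ^ b := by
  intro h
  have := Nat.Coprime.eq_one_of_dvd (Nat.Coprime.pow_right b hc) h
  omega

lemma fiber_upper {p q : ℕ} (hp : 1 < p) (hc : Nat.Coprime p q) (n : ℕ) (b : Finset ℕ) :
    ((RepF p q n).filter (fun S => S.filter (fun k => ¬ p ∣ k) = b)).card ≤
      (RepF p q ((n - b.sum id) / p)).card := by
  have hinj : ∀ S : Finset ℕ, Set.InjOn (· / p) (S.filter (p ∣ ·) : Finset ℕ) := by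
    intro S x hx y hy h
    simp only [Finset.coe_filter, Set.mem_ofPred_eq] at hx hy
    exact (Nat.div_left_inj hx.2 hy.2).1 h
  apply Finset.card_le_card_of_injOn (fun S => (S.filter (p ∣ ·)).image (· / p))
  · intro S hS
    rw [Finset.mem_coe, Finset.mem_filter, mem_RepF] at hS
    obtain ⟨⟨h1, h2⟩, h3⟩ := hS
    rw [Finset.mem_coe, mem_RepF]
    constructor
    · intro k hk
      obtain ⟨j, hj, rfl⟩ := Finset.mem_image.1 hk
      rw [Finset.mem_filter] at hj
      obtain ⟨a, b, rfl⟩ := h1 j hj.1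
      cases a with
      | zero => 
        have := not_dvd_qpow hp hc b
        simp at hj
        exact absurd hj.2 this
      | succ a =>
        refine ⟨a, b, ?_⟩
        apply Nat.div_eq_of_eq_mul_left (by omega)
        ring
    · rw [Finset.sum_image (hinj S)]
      symm
      apply Nat.div_eq_of_eq_mul_left (by omega)
      rw [Finset.sum_mul]
      have h4 : ∑ i ∈ S.filter (p ∣ ·), id (i / p) * p = ∑ i ∈ S.filter (p ∣ ·), id i := by
        apply Finset.sum_congr rfl
        intro i hi
        exact Nat.div_mul_cancel (Finset.mem_filter.1 hi).2
      have h5 := Finset.sum_filter_add_sum_filter_not S (p ∣ ·) id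
      rw [h3, h2] at h5
      rw [h4]
      have he : ∑ x ∈ b, id x = b.sum id := rfl
      omega
  · intro S hS S' hS' h
    rw [Finset.mem_coe, Finset.mem_filter] at hS hS'
    have key : ∀ S : Finset ℕ, ((S.filter (p ∣ ·)).image (· / p)).image (· * p) =
        S.filter (p ∣ ·) := by
      intro S
      rw [Finset.image_image]
      conv_rhs => rw [← Finset.image_id (s := S.filter (p ∣ ·))]
      apply Finset.image_congr
      intro i hi
      simp only [Finset.coe_filter, Set.mem_ofPred_eq] at hi
      exact Nat.div_mul_cancel hi.2
    have h1 := key S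
    have h2 := key S'
    simp only at h
    rw [h, h2] at h1
    rw [← Finset.filter_union_filter_not_eq (p ∣ ·) S, ← Finset.filter_union_filter_not_eq (p ∣ ·) S',
      h1, hS.2, hS'.2]

lemma fiber_lower {p q : ℕ} (hp : 1 < p) (hc : Nat.Coprime p q) (n : ℕ) (b : Finset ℕ)
    (hb : ∀ k ∈ b, ∃ j, k = q ^ j) (hle : b.sum id ≤ n) (hd : p ∣ n - b.sum id) :
    (RepF p q ((n - b.sum id) / p)).card ≤
    ((RepF p q n).filter (fun S => S.filter (fun k => ¬ p ∣ k) = b)).card := by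
  have hinj : Function.Injective (p * ·) := fun x y h => Nat.eq_of_mul_eq_mul_left (by omega) h
  have hbp : ∀ k ∈ b, ¬ p ∣ k := by
    intro k hk
    obtain ⟨j, rfl⟩ := hb k hk
    exact not_dvd_qpow hp hc j
  have hdisj : ∀ S : Finset ℕ, Disjoint b (S.image (p * ·)) := by
    intro S
    rw [Finset.disjoint_left]
    intro k hk hk'
    obtain ⟨j, _, rfl⟩ := Finset.mem_image.1 hk'
    exact hbp _ hk (Dvd.intro _ rfl)
  apply Finset.card_le_card_of_injOn (fun S => b ∪ S.image (p * ·))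
  · intro S hS
    rw [Finset.mem_coe, mem_RepF] at hS
    rw [Finset.mem_coe, Finset.mem_filter, mem_RepF]
    refine ⟨⟨?_, ?_⟩, ?_⟩
    · intro k hk
      rcases Finset.mem_union.1 hk with h | h
      · obtain ⟨j, rfl⟩ := hb k h
        exact ⟨0, j, by simp⟩
      · obtain ⟨j, hj, rfl⟩ := Finset.mem_image.1 h
        obtain ⟨a, c, rfl⟩ := hS.1 j hj
        exact ⟨a + 1, c, by ring⟩
    · rw [Finset.sum_union (hdisj S), Finset.sum_image hinj.injOn]
      have : ∑ x ∈ S, id (p * x) = p * S.sum id := by rw [Finset.mul_sum]; rfl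
      rw [this, hS.2, Nat.mul_div_cancel' hd]
      have he : ∑ x ∈ b, id x = b.sum id := rfl
      omega
    · ext k
      simp only [Finset.mem_filter, Finset.mem_union, Finset.mem_image]
      constructor
      · rintro ⟨h | ⟨j, _, rfl⟩, h2⟩
        · exact h
        · exact absurd (Dvd.intro _ rfl) h2
      · exact fun h => ⟨Or.inl h, hbp k h⟩
  · intro S hS S' hS' h
    simp only at h
    have : S.image (p * ·) = S'.image (p * ·) := by
      rw [← Finset.union_sdiff_cancel_left (hdisj S), ← Finset.union_sdiff_cancel_left (hdisj S'), h]
    exact Finset.image_injective hinj this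

lemma upper {p q : ℕ} (hp : 1 < p) (hq : 1 < q) (hc : Nat.Coprime p q) (k : ℕ) :
    ∀ n < p ^ k, (RepF p q n).card ≤ 2 ^ (∑ i ∈ Finset.range k, (Nat.log q (p ^ (i + 1)) + 1)) := by
  induction k with
  | zero =>
    intro n hn
    simp at hn ⊢
    subst hn
    rw [Finset.card_le_one]
    have : ∀ S ∈ RepF p q 0, S = ∅ := by
      intro S hS
      rw [mem_RepF] at hS
      rw [Finset.eq_empty_iff_forall_notMem]
      intro k hk
      have h1 := Finset.sum_eq_zero_iff.1 hS.2 k hk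
      obtain ⟨a, b, rfl⟩ := hS.1 k hk
      have : 0 < p ^ a * q ^ b := by positivity
      simp only [id] at h1
      omega
    intro S hS S' hS'
    rw [this S hS, this S' hS']
  | succ k ih =>
    intro n hn
    rw [Finset.sum_range_succ, pow_add]
    set B := Nat.log q (p ^ (k + 1)) + 1
    have h := Finset.card_le_mul_card_image_of_maps_to (s := RepF p q n)
      (f := fun S => S.filter (fun k => ¬ p ∣ k))
      (t := ((Finset.range B).image (q ^ ·)).powerset) ?_ 
      (2 ^ (∑ i ∈ Finset.range k, (Nat.log q (p ^ (i + 1)) + 1))) ?_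
    · refine h.trans ?_
      gcongr
      rw [Finset.card_powerset]
      apply Nat.pow_le_pow_right (by norm_num)
      exact Finset.card_image_le.trans (by simp)
    · intro S hS
      rw [Finset.mem_powerset]
      intro j hj
      rw [mem_RepF] at hS
      have hj' := Finset.mem_filter.1 hj
      obtain ⟨a, b, hab⟩ := hS.1 j hj'.1
      have hle : id j ≤ S.sum id := Finset.single_le_sum (fun _ _ => Nat.zero_le _) hj'.1
      rw [hS.2] at hle
      simp only [id] at hle
      cases a with
      | zero =>
        simp only [pow_zero, one_mul] at hab
        rw [Finset.mem_image]
        refine ⟨b, ?_, hab.symm⟩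
        rw [Finset.mem_range, Nat.lt_succ_iff]
        apply Nat.le_log_of_pow_le hq
        omega
      | succ a =>
        exfalso
        apply hj'.2
        rw [hab, pow_succ, mul_comm (p ^ a) p, mul_assoc]
        exact Dvd.intro _ rfl
    · intro b hb
      refine (fiber_upper hp hc n b).trans (ih _ ?_)
      rw [Nat.div_lt_iff_lt_mul (by omega), ← pow_succ]
      omega

lemma lower {p q : ℕ} (hp : 1 < p) (hq : 1 < q) (hc : Nat.Coprime p q) :
    ∃ N c K : ℕ, ∀ k n, p ^ k * (N + c * k) ≤ n →
      2 ^ (∑ i ∈ Finset.range k, (Nat.log q (p ^ (i + 1)) - K)) ≤ (RepF p q n).card := by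
  obtain ⟨N, hN⟩ := birch hp hq hc
  set φ := Nat.totient p with hφ
  have hφ0 : 0 < φ := Nat.totient_pos.2 (by omega)
  have hqφ : q ^ φ ≡ 1 [MOD p] := Nat.ModEq.pow_totient hc.symm
  set K := φ * p with hK
  refine ⟨N, 1 + q ^ K, K, fun k => ?_⟩
  induction k with
  | zero =>
    intro n hn
    simp at hn ⊢
    obtain ⟨S, hS⟩ := hN n hn
    exact ⟨S, mem_RepF.2 hS⟩
  | succ k ih =>
    intro n hn
    rw [Finset.sum_range_succ, pow_add]
    have hpk : 0 < p ^ (k + 1) := pow_pos (by omega) _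
    set B := Nat.log q (p ^ (k + 1)) with hB
    have hqB : q ^ B ≤ p ^ (k + 1) := Nat.pow_log_le_self q hpk.ne'
    set ex : Finset ℕ → Finset ℕ := fun E =>
      E ∪ (Finset.range ((n - ∑ j ∈ E, q ^ j) % p)).image (fun i => φ * i) with hex
    have hfix : ∀ E : Finset ℕ, ∀ j ∈ (Finset.range ((n - ∑ j ∈ E, q ^ j) % p)).image
        (fun i => φ * i), j < K := by
      intro E j hj
      obtain ⟨i, hi, rfl⟩ := Finset.mem_image.1 hj
      rw [Finset.mem_range] at hi
      have := Nat.mod_lt (n - ∑ j ∈ E, q ^ j) (show 0 < p by omega)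
      exact Nat.mul_lt_mul_of_pos_left (by omega) hφ0
    have hdis : ∀ E ⊆ Finset.Ico K B, Disjoint E ((Finset.range ((n - ∑ j ∈ E, q ^ j) % p)).image
        (fun i => φ * i)) := by
      intro E hE
      rw [Finset.disjoint_left]
      intro j hj hj'
      have h1 := hfix E j hj'
      have h2 := Finset.mem_Ico.1 (hE hj)
      omega
    set bs : Finset ℕ → Finset ℕ := fun E => (ex E).image (q ^ ·) with hbs
    have hqinj := Nat.pow_right_injective hq
    have hinj : Set.InjOn bs ((Finset.Ico K B).powerset : Finset (Finset ℕ)) := by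
      intro E hE E' hE' h
      have h1 : ex E = ex E' := Finset.image_injective hqinj h
      have key : ∀ E ⊆ Finset.Ico K B, (ex E).filter (K ≤ ·) = E := by
        intro E hE
        ext j
        simp only [hex, Finset.mem_filter, Finset.mem_union]
        constructor
        · rintro ⟨h | h, h2⟩
          · exact h
          · have := hfix E j h; omega
        · intro h
          exact ⟨Or.inl h, (Finset.mem_Ico.1 (hE h)).1⟩
      simp only [Finset.mem_coe, Finset.mem_powerset] at hE hE'
      rw [← key E hE, ← key E' hE', h1]
    have hsum : ∀ E ⊆ Finset.Ico K B, (bs E).sum id ≤ p ^ (k + 1) * (1 + q ^ K) ∧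
        ((bs E).sum id ≤ n → p ∣ n - (bs E).sum id) := by
      intro E hE
      have e1 : (bs E).sum id = ∑ j ∈ E, q ^ j +
          ∑ i ∈ Finset.range ((n - ∑ j ∈ E, q ^ j) % p), q ^ (φ * i) := by
        simp only [hbs, hex]
        rw [Finset.sum_image hqinj.injOn, Finset.sum_union (hdis E hE)]
        congr 1
        rw [Finset.sum_image]
        · rfl
        · intro x _ y _ h
          exact Nat.eq_of_mul_eq_mul_left hφ0 h
      have e2 : (bs E).sum id = ∑ j ∈ E, q ^ j + ∑ j ∈ (Finset.range
          ((n - ∑ j ∈ E, q ^ j) % p)).image (fun i => φ * i), q ^ j := by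
        simp only [hbs, hex]
        rw [Finset.sum_image hqinj.injOn, Finset.sum_union (hdis E hE)]
        rfl
      constructor
      · rw [e2]
        have h1 := Nat.geomSum_lt hq (hfix E)
        have h2 : ∑ j ∈ E, q ^ j < q ^ B :=
          Nat.geomSum_lt hq (fun j hj => (Finset.mem_Ico.1 (hE hj)).2)
        have h3 : q ^ K ≤ p ^ (k + 1) * q ^ K := Nat.le_mul_of_pos_left _ hpk
        rw [mul_add]
        omega
      · intro hle
        have h3 : ∀ r, ∑ i ∈ Finset.range r, q ^ (φ * i) ≡ r [MOD p] := by
          intro r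
          induction r with
          | zero => simp; rfl
          | succ r ih =>
            rw [Finset.sum_range_succ]
            refine Nat.ModEq.add ih ?_
            rw [pow_mul]
            simpa using hqφ.pow r
        rw [e1] at hle ⊢
        rw [← Nat.sub_sub]
        have h4 := (h3 ((n - ∑ j ∈ E, q ^ j) % p)).trans (Nat.mod_modEq _ _)
        exact (Nat.modEq_iff_dvd' (by omega)).1 h4
    have hcard : ((Finset.Ico K B).powerset.image bs).card = 2 ^ (B - K) := by
      rw [Finset.card_image_of_injOn hinj, Finset.card_powerset, Nat.card_Ico]
    rw [← hcard]
    have hbig : ∀ E ⊆ Finset.Ico K B, (bs E).sum id ≤ n ∧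
        p ^ k * (N + (1 + q ^ K) * k) ≤ (n - (bs E).sum id) / p := by
      intro E hE
      have h1 := (hsum E hE).1
      have h2 : p ^ (k + 1) * (N + (1 + q ^ K) * (k + 1)) =
        p ^ k * (N + (1 + q ^ K) * k) * p + p ^ (k + 1) * (1 + q ^ K) := by ring
      refine ⟨by omega, ?_⟩
      rw [Nat.le_div_iff_mul_le (by omega)]
      omega
    have hfib : ∀ b ∈ (Finset.Ico K B).powerset.image bs,
        2 ^ (∑ i ∈ Finset.range k, (Nat.log q (p ^ (i + 1)) - K)) ≤
        ((RepF p q n).filter (fun S => S.filter (fun k => ¬ p ∣ k) = b)).card := by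
      intro b hb
      obtain ⟨E, hE, rfl⟩ := Finset.mem_image.1 hb
      rw [Finset.mem_powerset] at hE
      have h1 := hbig E hE
      refine (ih _ h1.2).trans (fiber_lower hp hc n _ ?_ h1.1 ((hsum E hE).2 h1.1))
      intro j hj
      obtain ⟨i, _, rfl⟩ := Finset.mem_image.1 hj
      exact ⟨i, rfl⟩
    refine le_trans ?_ (Finset.card_filter_le (RepF p q n)
      (fun S => S.filter (fun k => ¬ p ∣ k) ∈ (Finset.Ico K B).powerset.image bs))
    refine Finset.mul_card_image_le_card_of_maps_to
      (f := fun S : Finset ℕ => S.filter (fun k => ¬ p ∣ k)) ?_ _ ?_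
    · intro S hS
      exact (Finset.mem_filter.1 hS).2
    · intro b hb
      refine (hfib b hb).trans (Finset.card_le_card ?_)
      intro S hS
      rw [Finset.mem_filter] at hS ⊢
      exact ⟨Finset.mem_filter.2 ⟨hS.1, by rw [hS.2]; exact hb⟩, hS.2⟩

lemma log_bounds {p q : ℕ} (hp : 1 < p) (hq : 1 < q) (i : ℕ) :
    (Nat.log q (p ^ (i + 1)) : ℝ) ≤ (i + 1) * (Real.log p / Real.log q) ∧
    (i + 1) * (Real.log p / Real.log q) - 1 ≤ (Nat.log q (p ^ (i + 1)) : ℝ) := by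
  have hlq : 0 < Real.log q := Real.log_pos (by exact_mod_cast hq)
  have hpk : 0 < p ^ (i + 1) := pow_pos (by omega) _
  have h1 : q ^ Nat.log q (p ^ (i + 1)) ≤ p ^ (i + 1) := Nat.pow_log_le_self q hpk.ne'
  have h2 : p ^ (i + 1) < q ^ (Nat.log q (p ^ (i + 1)) + 1) := Nat.lt_pow_succ_log_self hq _
  set B := Nat.log q (p ^ (i + 1))
  have h1' : Real.log ((q : ℝ) ^ B) ≤ Real.log ((p : ℝ) ^ (i + 1)) :=
    Real.log_le_log (by positivity) (by exact_mod_cast h1)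
  have h2' : Real.log ((p : ℝ) ^ (i + 1)) ≤ Real.log ((q : ℝ) ^ (B + 1)) :=
    Real.log_le_log (by positivity) (by exact_mod_cast h2.le)
  rw [Real.log_pow, Real.log_pow] at h1' h2'
  push_cast at h1' h2'
  constructor
  · rw [← mul_div_assoc, le_div_iff₀ hlq]; exact h1'
  · rw [← mul_div_assoc, sub_le_iff_le_add, div_le_iff₀ hlq]; exact h2'

lemma sum_real (k : ℕ) (t c : ℝ) :
    ∑ i ∈ Finset.range k, (((i : ℝ) + 1) * t + c) = t * (k * (k + 1) / 2) + c * k := by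
  induction k with
  | zero => simp
  | succ k ih => rw [Finset.sum_range_succ, ih]; push_cast; ring

lemma tendsto_poly {d t A B : ℝ} (hd : 0 < d) :
    Tendsto (fun s : ℝ => s * (s * (s * (d * s - t) - A)) - B) atTop atTop := by
  have h1 : Tendsto (fun s : ℝ => d * s - t) atTop atTop :=
    tendsto_atTop_add_const_right _ (-t) (tendsto_id.const_mul_atTop hd)
  have h2 : Tendsto (fun s : ℝ => s * (d * s - t) - A) atTop atTop :=
    tendsto_atTop_add_const_right _ (-A) (tendsto_id.atTop_mul_atTop₀ h1)
  exact tendsto_atTop_add_const_right _ (-B)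
    (tendsto_id.atTop_mul_atTop₀ (tendsto_id.atTop_mul_atTop₀ h2))

lemma ev_pow (N c : ℕ) : ∀ᶠ L : ℕ in atTop, N + c * L ≤ 2 ^ Nat.sqrt L := by
  have h1 := tendsto_pow_const_div_const_pow_of_one_lt 2 (show (1 : ℝ) < 2 by norm_num)
  have hpos : (0 : ℝ) < 1 / (N + 3 * c + 1) := by positivity
  have h2 : ∀ᶠ j : ℕ in atTop, N + c * (j ^ 2 + 2 * j) ≤ 2 ^ j := by
    filter_upwards [h1.eventually (gt_mem_nhds hpos), eventually_ge_atTop 1] with j hj hj1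
    rw [div_lt_div_iff₀ (by positivity) (by positivity)] at hj
    have h3 : j ^ 2 * (N + 3 * c + 1) < 1 * 2 ^ j := by exact_mod_cast hj
    have h4 : j ≤ j ^ 2 := by nlinarith
    have h5 : 1 ≤ j ^ 2 := by nlinarith
    nlinarith
  have h3 : Tendsto Nat.sqrt atTop atTop := by
    refine tendsto_atTop_atTop_of_monotone (fun a b h => Nat.sqrt_le_sqrt h) (fun b => ⟨b * b, ?_⟩)
    rw [Nat.sqrt_eq]
  filter_upwards [h3.eventually h2] with L hL
  refine le_trans ?_ hL
  have := Nat.sqrt_le_add L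
  gcongr
  nlinarith

theorem stmt3 (p q₁ q₂ : ℕ) (hp : 1 < p) (h1 : p < q₁) (h2 : q₁ < q₂)
    (hc1 : Nat.Coprime p q₁) (hc2 : Nat.Coprime p q₂) :
    Filter.Tendsto (fun n : ℕ => (fpq p q₂ n : ℝ) / (fpq p q₁ n))
      Filter.atTop (nhds 0) ∧
    ∀ᶠ n : ℕ in Filter.atTop, fpq p q₂ n < fpq p q₁ n := by
  have hq1 : 1 < q₁ := by omega
  have hq2 : 1 < q₂ := by omega
  obtain ⟨N, c, K, hlow⟩ := lower hp hq1 hc1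
  set t1 : ℝ := Real.log p / Real.log q₁ with ht1
  set t2 : ℝ := Real.log p / Real.log q₂ with ht2
  have hlp : 0 < Real.log p := Real.log_pos (by exact_mod_cast hp)
  have hl1 : 0 < Real.log q₁ := Real.log_pos (by exact_mod_cast hq1)
  have hl12 : Real.log q₁ < Real.log q₂ :=
    Real.log_lt_log (by exact_mod_cast (by omega : 0 < q₁)) (by exact_mod_cast h2)
  have ht : t2 < t1 := div_lt_div_of_pos_left hlp hl1 hl12
  have ht1p : 0 < t1 := div_pos hlp hl1
  have ht2p : 0 < t2 := div_pos hlp (hl1.trans hl12)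
  set D : ℝ → ℝ := fun s =>
    s * (s * (s * ((t1 - t2) / 2 * s - t1) - (2 + K + 3 * t2 / 2))) - (1 + t2) with hD
  have hDt : Tendsto D atTop atTop := tendsto_poly (by linarith)
  have hlog : Tendsto (fun n => Nat.log p n) atTop atTop := by
    refine tendsto_atTop_atTop_of_monotone (fun a b h => Nat.log_mono_right h)
      (fun b => ⟨p ^ b, ?_⟩)
    rw [Nat.log_pow hp]
  have hsq : Tendsto (fun n : ℕ => Real.sqrt (Nat.log p n : ℝ)) atTop atTop :=
    Real.tendsto_sqrt_atTop.comp (tendsto_natCast_atTop_atTop.comp hlog)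
  have main : ∀ᶠ n : ℕ in atTop, 0 < fpq p q₁ n ∧
      (fpq p q₂ n : ℝ) / (fpq p q₁ n) ≤ (2 : ℝ) ^ (-(D (Real.sqrt (Nat.log p n : ℝ)))) := by
    filter_upwards [hlog.eventually (ev_pow N c), eventually_ge_atTop 1] with n hn hn1
    set L := Nat.log p n with hL
    set j := Nat.sqrt L with hj
    have hjL : j ≤ L := Nat.sqrt_le_self L
    have hpL : p ^ L ≤ n := Nat.pow_log_le_self p (by omega)
    have hnL : n < p ^ (L + 1) := Nat.lt_pow_succ_log_self hp n
    have hA := hlow (L - j) n (by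
      calc p ^ (L - j) * (N + c * (L - j)) ≤ p ^ (L - j) * p ^ j := by
            apply Nat.mul_le_mul_left
            calc N + c * (L - j) ≤ N + c * L := by gcongr; omega
              _ ≤ 2 ^ j := hn
              _ ≤ p ^ j := Nat.pow_le_pow_left hp j
        _ = p ^ L := by rw [← pow_add]; congr 1; omega
        _ ≤ n := hpL)
    have hB := upper hp hq2 hc2 (L + 1) n hnL
    rw [← fpq_eq] at hA hB
    set e1 := ∑ i ∈ Finset.range (L - j), (Nat.log q₁ (p ^ (i + 1)) - K) with he1
    set e2 := ∑ i ∈ Finset.range (L + 1), (Nat.log q₂ (p ^ (i + 1)) + 1) with he2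
    have hpos : 0 < fpq p q₁ n := lt_of_lt_of_le (by positivity) hA
    refine ⟨hpos, ?_⟩
    have hE1 : t1 * (((L - j : ℕ) : ℝ) * (((L - j : ℕ) : ℝ) + 1) / 2) +
        (-(1 + K)) * ((L - j : ℕ) : ℝ) ≤ (e1 : ℝ) := by
      rw [← sum_real, he1]
      push_cast
      apply Finset.sum_le_sum
      intro i _
      have h3 := (log_bounds hp hq1 i).2
      have h4 : (Nat.log q₁ (p ^ (i + 1)) : ℝ) ≤
          ((Nat.log q₁ (p ^ (i + 1)) - K : ℕ) : ℝ) + K := by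
        exact_mod_cast (by omega : Nat.log q₁ (p ^ (i + 1)) ≤ Nat.log q₁ (p ^ (i + 1)) - K + K)
      linarith
    have hE2 : (e2 : ℝ) ≤ t2 * (((L + 1 : ℕ) : ℝ) * (((L + 1 : ℕ) : ℝ) + 1) / 2) +
        1 * ((L + 1 : ℕ) : ℝ) := by
      rw [← sum_real, he2]
      push_cast
      apply Finset.sum_le_sum
      intro i _
      have h3 := (log_bounds hp hq2 i).1
      linarith
    rw [Nat.cast_sub hjL] at hE1
    push_cast at hE2
    set s := Real.sqrt (L : ℝ) with hs
    have hs0 : 0 ≤ s := Real.sqrt_nonneg _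
    have hsL : (L : ℝ) = s ^ 2 := (Real.sq_sqrt (Nat.cast_nonneg L)).symm
    have hjs : (j : ℝ) ≤ s := by
      rw [hs]
      apply Real.le_sqrt_of_sq_le
      exact_mod_cast Nat.sqrt_le' L
    have hj0 : (0 : ℝ) ≤ j := Nat.cast_nonneg j
    have hjL' : (j : ℝ) ≤ s ^ 2 := by rw [← hsL]; exact_mod_cast hjL
    have hfin : D s ≤ (e1 : ℝ) - e2 := by
      rw [hsL] at hE1 hE2
      have hx : s ^ 4 - 2 * s ^ 3 ≤ (s ^ 2 - j) * (s ^ 2 - j + 1) := by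
        have : s ^ 2 * j ≤ s ^ 2 * s := by gcongr
        nlinarith [sq_nonneg (j : ℝ)]
      have hy : t1 * ((s ^ 4 - 2 * s ^ 3) / 2) ≤ t1 * ((s ^ 2 - j) * (s ^ 2 - j + 1) / 2) := by
        gcongr
      have hz : 0 ≤ (1 + (K : ℝ)) * j := by positivity
      simp only [hD]
      nlinarith
    have hB' : (fpq p q₂ n : ℝ) ≤ (2 : ℝ) ^ (e2 : ℝ) := by
      rw [Real.rpow_natCast]; exact_mod_cast hB
    have hA' : (2 : ℝ) ^ (e1 : ℝ) ≤ (fpq p q₁ n : ℝ) := by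
      rw [Real.rpow_natCast]; exact_mod_cast hA
    calc (fpq p q₂ n : ℝ) / (fpq p q₁ n) ≤ (2 : ℝ) ^ (e2 : ℝ) / (2 : ℝ) ^ (e1 : ℝ) := by
          gcongr
      _ = (2 : ℝ) ^ ((e2 : ℝ) - e1) := by rw [Real.rpow_sub (by norm_num)]
      _ ≤ _ := by
        apply Real.rpow_le_rpow_of_exponent_le (by norm_num)
        linarith
  have hlim : Tendsto (fun n : ℕ => (2 : ℝ) ^ (-(D (Real.sqrt (Nat.log p n : ℝ))))) atTop
      (nhds 0) :=
    (tendsto_rpow_atBot_of_base_gt_one 2 (by norm_num)).comp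
      (tendsto_neg_atTop_atBot.comp (hDt.comp hsq))
  have hT : Filter.Tendsto (fun n : ℕ => (fpq p q₂ n : ℝ) / (fpq p q₁ n))
      Filter.atTop (nhds 0) := by
    refine tendsto_of_tendsto_of_tendsto_of_le_of_le' tendsto_const_nhds hlim ?_ ?_
    · exact Eventually.of_forall fun n => by positivity
    · exact main.mono fun n hn => hn.2
  refine ⟨hT, ?_⟩
  filter_upwards [main, hT.eventually (gt_mem_nhds (show (0 : ℝ) < 1 by norm_num))] with n hn hn'
  have h0 : (0 : ℝ) < fpq p q₁ n := by exact_mod_cast hn.1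
  rw [div_lt_one h0] at hn'
  exact_mod_cast hn'
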